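/- For n ≥ 1, let H_n be the random variable 'total height' (sum over all vertices of the distance to the root) on the set of complete binary trees with 2n+1 vertices, equipped with the uniform distribution. Let μ(n) = E[H_n], m_i(n) = E[(H_n − μ(n))^i], and α_i(n) = m_i(n)/m_2(n)^{i/2}. Then lim_{n→∞} α_8(n) = (3/2586584)·(−488864376π⁴ − 8147739600π³ − 455885430π² + 86568885375π + 32820007040)/(10 − 3π)⁴ ≈ 358.80904151261251…. -/

import Mathlib

inductive PTree : Type
  | node : List PTree → PTree

namespace PTree

/-- Number of vertices of an ordered rooted (plane) tree. -/
def size : PTree → ℕ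
  | node ts => 1 + (ts.attach.map fun t => size t.1).sum
decreasing_by
  have := List.sizeOf_lt_of_mem t.2
  simp only [PTree.node.sizeOf_spec]
  omega

/-- Total height: sum over all vertices of the distance to the root. -/
def totalHeight : PTree → ℕ
  | node ts => (ts.attach.map fun t => totalHeight t.1 + size t.1).sum
decreasing_by
  have := List.sizeOf_lt_of_mem t.2
  simp only [PTree.node.sizeOf_spec]
  omega

/-- Every vertex has no children, or a number of children belonging to `S`. -/
def validDeg (S : Finset ℕ) : PTree → Prop
  | node ts => (ts = [] ∨ ts.length ∈ S) ∧ ∀ t ∈ ts, validDeg S t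
decreasing_by
  have := List.sizeOf_lt_of_mem (by assumption : t ∈ ts)
  simp only [PTree.node.sizeOf_spec]
  omega

end PTree

open Filter Real

namespace TH

open PTree

def leaf : PTree := PTree.node []

lemma size_leaf : leaf.size = 1 := by
  simp [leaf, PTree.size]

lemma th_leaf : leaf.totalHeight = 0 := by
  simp [leaf, PTree.totalHeight]

lemma valid_leaf : leaf.validDeg {2} := by
  simp [leaf, PTree.validDeg]

lemma size_node (l r : PTree) : (PTree.node [l, r]).size = 1 + (l.size + r.size) := by
  rw [PTree.size]; simp

lemma th_node (l r : PTree) : (PTree.node [l, r]).totalHeight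
    = (l.totalHeight + l.size) + (r.totalHeight + r.size) := by
  rw [PTree.totalHeight]; simp

lemma valid_node (l r : PTree) : (PTree.node [l, r]).validDeg {2} ↔
    l.validDeg {2} ∧ r.validDeg {2} := by
  rw [PTree.validDeg]; simp

lemma valid_cases (t : PTree) (h : t.validDeg {2}) :
    t = leaf ∨ ∃ l r, t = PTree.node [l, r] ∧ l.validDeg {2} ∧ r.validDeg {2} := by
  obtain ⟨ts⟩ := t
  have h' := h
  rw [PTree.validDeg] at h
  obtain ⟨h1, h2⟩ := h
  rcases h1 with rfl | h1
  · left; rfl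
  · right
    rw [Finset.mem_singleton, List.length_eq_two] at h1
    obtain ⟨l, r, rfl⟩ := h1
    exact ⟨l, r, rfl, (valid_node l r).1 h'⟩

lemma size_odd (t : PTree) (h : t.validDeg {2}) : ∃ N, 1 ≤ N ∧ t.size + 1 = 2 * N := by
  suffices H : ∀ n, ∀ t : PTree, t.size ≤ n → t.validDeg {2} → ∃ N, 1 ≤ N ∧ t.size + 1 = 2 * N from
    H t.size t le_rfl h
  intro n
  induction n with
  | zero =>
    intro t ht
    obtain ⟨ts⟩ := t
    rw [PTree.size] at ht
    omega
  | succ n ih =>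
    intro t ht h
    rcases valid_cases t h with rfl | ⟨l, r, rfl, hl, hr⟩
    · exact ⟨1, le_rfl, by rw [size_leaf]⟩
    · rw [size_node] at ht
      obtain ⟨a, ha, ha'⟩ := ih l (by omega) hl
      obtain ⟨b, hb, hb'⟩ := ih r (by omega) hr
      refine ⟨a + b, by omega, ?_⟩
      rw [size_node]; omega

open Classical in
lemma U_sum (U : ℕ → Finset PTree)
    (hU : ∀ N t, t ∈ U N ↔ t.size + 1 = 2 * N ∧ t.validDeg {2}) (f : PTree → ℝ) (N : ℕ) :
    ∑ t ∈ U N, f t = (if N = 1 then f leaf else 0) +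
      ∑ p ∈ Finset.HasAntidiagonal.antidiagonal N, ∑ l ∈ U p.1, ∑ r ∈ U p.2, f (PTree.node [l, r]) := by
  have key : U N = (if N = 1 then {leaf} else ∅) ∪ (Finset.HasAntidiagonal.antidiagonal N).biUnion
      (fun p => (U p.1 ×ˢ U p.2).image (fun q => PTree.node [q.1, q.2])) := by
    ext t
    rw [Finset.mem_union, Finset.mem_biUnion, hU]
    constructor
    · rintro ⟨h1, h2⟩
      rcases valid_cases t h2 with rfl | ⟨l, r, rfl, hl, hr⟩
      · left
        rw [size_leaf] at h1
        have : N = 1 := by omega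
        simp [this]
      · right
        obtain ⟨a, ha, ha'⟩ := size_odd l hl
        obtain ⟨b, hb, hb'⟩ := size_odd r hr
        rw [size_node] at h1
        refine ⟨(a, b), Finset.HasAntidiagonal.mem_antidiagonal.2 (by show a + b = N; omega), ?_⟩
        rw [Finset.mem_image]
        exact ⟨(l, r), Finset.mem_product.2 ⟨(hU _ _).2 ⟨ha', hl⟩, (hU _ _).2 ⟨hb', hr⟩⟩, rfl⟩
    · rintro (h | ⟨p, hp, h⟩)
      · split_ifs at h with hN
        · rw [Finset.mem_singleton] at h
          subst h
          exact ⟨by rw [size_leaf, hN], valid_leaf⟩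
        · simp at h
      · rw [Finset.mem_image] at h
        obtain ⟨⟨l, r⟩, hq, rfl⟩ := h
        obtain ⟨hl, hr⟩ := Finset.mem_product.1 hq
        rw [hU] at hl hr
        rw [Finset.HasAntidiagonal.mem_antidiagonal] at hp
        simp only at hl hr
        refine ⟨?_, (valid_node _ _).2 ⟨hl.2, hr.2⟩⟩
        have := size_node l r
        show (PTree.node [l, r]).size + 1 = 2 * N
        omega
  rw [key, Finset.sum_union, Finset.sum_biUnion]
  · congr 1
    · split_ifs <;> simp
    · refine Finset.sum_congr rfl fun p _ => ?_
      rw [Finset.sum_image, Finset.sum_product]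
      rintro ⟨a, b⟩ _ ⟨c, d⟩ _ h
      simpa using h
  · intro p hp q hq hpq
    rw [Function.onFun, Finset.disjoint_left]
    intro t ht ht'
    rw [Finset.mem_image] at ht ht'
    obtain ⟨⟨l, r⟩, h1, rfl⟩ := ht
    obtain ⟨⟨l', r'⟩, h2, h3⟩ := ht'
    simp only [PTree.node.injEq, List.cons.injEq, and_true] at h3
    obtain ⟨rfl, rfl⟩ := h3
    obtain ⟨hl, hr⟩ := Finset.mem_product.1 h1
    obtain ⟨hl', hr'⟩ := Finset.mem_product.1 h2
    rw [hU] at hl hr hl' hr'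
    simp only at hl hr hl' hr'
    exact hpq (Prod.ext (by omega) (by omega))
  · rw [Finset.disjoint_left]
    intro t ht ht'
    split_ifs at ht with hN
    · rw [Finset.mem_singleton] at ht
      subst ht
      simp [leaf] at ht'
    · simp at ht

/-- external path length -/
noncomputable def epl (t : PTree) : ℝ := ((t.totalHeight : ℝ) + t.size - 1) / 2

/-- moment generating functions -/
noncomputable def G (U : ℕ → Finset PTree) (k : ℕ) : PowerSeries ℝ :=
  PowerSeries.mk fun N => ∑ t ∈ U N, epl t ^ k

noncomputable def D (U : ℕ → Finset PTree) (k : ℕ) : PowerSeries ℝ :=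
  PowerSeries.mk fun N => ∑ t ∈ U N, (epl t + N) ^ k

open PowerSeries in
noncomputable def θ : PowerSeries ℝ →ₗ[ℝ] PowerSeries ℝ :=
  (LinearMap.mulLeft ℝ (PowerSeries.X : PowerSeries ℝ)) ∘ₗ
    (PowerSeries.derivative ℝ).toLinearMap

lemma coeff_θ (f : PowerSeries ℝ) (n : ℕ) :
    PowerSeries.coeff n (θ f) = n * PowerSeries.coeff n f := by
  cases n with
  | zero => simp [θ]
  | succ n =>
    simp [θ, PowerSeries.coeff_succ_X_mul, PowerSeries.coeff_derivative]
    ring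

lemma coeff_θ_pow (f : PowerSeries ℝ) (j n : ℕ) :
    PowerSeries.coeff n ((θ^[j]) f) = (n : ℝ) ^ j * PowerSeries.coeff n f := by
  induction j with
  | zero => simp
  | succ j ih => rw [Function.iterate_succ_apply', coeff_θ, ih]; ring

lemma D_eq (U : ℕ → Finset PTree) (k : ℕ) :
    D U k = ∑ j ∈ Finset.range (k + 1), (k.choose j : ℝ) • (θ^[j]) (G U (k - j)) := by
  ext N
  simp only [D, map_sum, PowerSeries.coeff_smul, coeff_θ_pow, G, PowerSeries.coeff_mk,
    smul_eq_mul, Finset.mul_sum]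
  rw [Finset.sum_comm]
  refine Finset.sum_congr rfl fun t _ => ?_
  rw [add_comm, add_pow]
  refine Finset.sum_congr rfl fun j _ => ?_
  ring

lemma epl_leaf : epl leaf = 0 := by
  simp [epl, size_leaf, th_leaf]

lemma epl_node (l r : PTree) (a b : ℕ) (ha : l.size + 1 = 2 * a) (hb : r.size + 1 = 2 * b) :
    epl (PTree.node [l, r]) = (epl l + a) + (epl r + b) := by
  have ha' : (l.size : ℝ) + 1 = 2 * a := by exact_mod_cast ha
  have hb' : (r.size : ℝ) + 1 = 2 * b := by exact_mod_cast hb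
  simp only [epl, size_node, th_node]
  push_cast
  linarith

lemma G_eq (U : ℕ → Finset PTree)
    (hU : ∀ N t, t ∈ U N ↔ t.size + 1 = 2 * N ∧ t.validDeg {2}) (k : ℕ) :
    G U k = (if k = 0 then PowerSeries.X else 0) +
      ∑ i ∈ Finset.range (k + 1), (k.choose i : ℝ) • (D U i * D U (k - i)) := by
  ext N
  simp only [G, PowerSeries.coeff_mk, map_add, map_sum, PowerSeries.coeff_smul,
    PowerSeries.coeff_mul, D, smul_eq_mul]
  rw [U_sum U hU]
  congr 1
  · rw [epl_leaf]
    by_cases hk : k = 0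
    · simp [hk, PowerSeries.coeff_X]
    · simp [hk]
  · simp only [Finset.mul_sum (Finset.HasAntidiagonal.antidiagonal N)]
    rw [Finset.sum_comm]
    refine Finset.sum_congr rfl fun p _ => ?_
    simp only [Finset.sum_mul_sum]
    simp only [Finset.mul_sum]
    rw [Finset.sum_comm (s := Finset.range (k + 1))]
    refine Finset.sum_congr rfl fun l hl => ?_
    rw [Finset.sum_comm (s := Finset.range (k + 1))]
    refine Finset.sum_congr rfl fun r hr => ?_
    rw [epl_node l r p.1 p.2 ((hU _ _).1 hl).1 ((hU _ _).1 hr).1, add_pow]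
    refine Finset.sum_congr rfl fun j _ => ?_
    ring

lemma D_zero (U : ℕ → Finset PTree) : D U 0 = G U 0 := by
  simp [D, G]

lemma θ_mul (f g : PowerSeries ℝ) : θ (f * g) = f * θ g + g * θ f := by
  simp only [θ, LinearMap.comp_apply, LinearMap.mulLeft_apply, Derivation.coeFn_coe, Derivation.leibniz, smul_eq_mul]
  ring

lemma θ_one : θ 1 = 0 := by
  simp [θ]

/-- integer powers of a unit -/
noncomputable def pw (s : (PowerSeries ℝ)ˣ) (j : ℤ) : PowerSeries ℝ := ((s ^ j : (PowerSeries ℝ)ˣ) : PowerSeries ℝ)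

lemma pw_add (s : (PowerSeries ℝ)ˣ) (i j : ℤ) : pw s (i + j) = pw s i * pw s j := by
  simp [pw, zpow_add]

lemma pw_zero (s : (PowerSeries ℝ)ˣ) : pw s 0 = 1 := by simp [pw]

lemma pw_one (s : (PowerSeries ℝ)ˣ) : pw s 1 = s := by simp [pw]

lemma θ_X : θ PowerSeries.X = PowerSeries.X := by
  simp [θ]

section unit

variable (s : (PowerSeries ℝ)ˣ)

lemma pw_two (hs : s.val * s.val = 1 - (4 : ℝ) • PowerSeries.X) :
    pw s 2 = 1 - (4 : ℝ) • PowerSeries.X := by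
  rw [← hs, show (2 : ℤ) = 1 + 1 by norm_num, pw_add, pw_one]

lemma θ_pw_one (hs : s.val * s.val = 1 - (4 : ℝ) • PowerSeries.X) :
    θ (pw s 1) = (1 / 2 : ℝ) • (pw s 1 - pw s (-1)) := by
  have h1 : θ (pw s 1 * pw s 1) = θ (1 - (4 : ℝ) • PowerSeries.X) := by
    rw [pw_one, hs]
  rw [θ_mul, map_sub, map_smul, θ_one, θ_X] at h1
  have h2 : (4 : ℝ) • (PowerSeries.X : PowerSeries ℝ) = 1 - pw s 1 * pw s 1 := by
    rw [pw_one, hs]; ring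
  rw [h2] at h1
  have h3 : pw s (-1) * pw s 1 = 1 := by rw [← pw_add, ← pw_zero s]; norm_num
  have h4 : (2 : ℝ) • θ (pw s 1) = pw s 1 - pw s (-1) := by
    rw [two_smul]
    linear_combination pw s (-1) * h1 - (2 * θ (pw s 1) - pw s 1) * h3
  rw [← h4, smul_smul]; norm_num

lemma θ_pw (hs : s.val * s.val = 1 - (4 : ℝ) • PowerSeries.X) (j : ℤ) :
    θ (pw s j) = ((j : ℝ) / 2) • (pw s j - pw s (j - 2)) := by
  have h3 : pw s 1 * pw s (-1) = 1 := by rw [← pw_add, ← pw_zero s]; norm_num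
  have hm : θ (pw s (-1)) = (-1 / 2 : ℝ) • (pw s (-1) - pw s (-3)) := by
    have h := congrArg θ h3
    rw [θ_mul, θ_one, θ_pw_one s hs] at h
    have e3 : pw s (-3) = pw s (-1) * pw s (-1) * pw s (-1) := by
      rw [← pw_add, ← pw_add]; norm_num
    rw [e3]
    rw [PowerSeries.smul_eq_C_mul] at h ⊢
    rw [show (-1 / 2 : ℝ) = - (1 / 2) by norm_num, map_neg]
    linear_combination pw s (-1) * h - (θ (pw s (-1)) + PowerSeries.C (1 / 2 : ℝ) * pw s (-1)) * h3
  induction j using Int.induction_on with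
  | zero => simp [pw_zero, θ_one]
  | succ i ih =>
    rw [pw_add, θ_mul, ih, θ_pw_one s hs, show (i : ℤ) + 1 - 2 = i + -1 by ring, pw_add,
      show (i : ℤ) - 2 = i + -1 + -1 by ring, pw_add, pw_add]
    simp only [PowerSeries.smul_eq_C_mul]
    push_cast
    rw [add_div, map_add]
    linear_combination (- PowerSeries.C ((i : ℝ) / 2) * pw s i * pw s (-1)) * h3
  | pred i ih =>
    rw [sub_eq_add_neg, pw_add, θ_mul, ih, hm, show -(i : ℤ) + -1 - 2 = -i + -3 by ring, pw_add,
      show -(i : ℤ) - 2 = -i + -2 by ring, pw_add, show (-3 : ℤ) = -1 + -2 by norm_num, pw_add]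
    simp only [PowerSeries.smul_eq_C_mul]
    push_cast
    rw [add_div, map_add]
    ring

lemma coeff_pw_succ (hs : s.val * s.val = 1 - (4 : ℝ) • PowerSeries.X) (j : ℤ) (n : ℕ) :
    ((n : ℝ) + 1) * PowerSeries.coeff (n + 1) (pw s j)
      = 4 * (n + -(j : ℝ) / 2) * PowerSeries.coeff n (pw s j) := by
  have h : (1 - (4 : ℝ) • PowerSeries.X) * θ (pw s j)
      = (-2 * j : ℝ) • (PowerSeries.X * pw s j) := by
    have e : pw s (j - 2) * pw s 2 = pw s j := by rw [← pw_add]; norm_num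
    have e2 := pw_two s hs
    rw [θ_pw s hs, show (-2 * j : ℝ) = (j / 2 : ℝ) * (-4) by ring]
    simp only [PowerSeries.smul_eq_C_mul, map_mul, map_neg] at *
    linear_combination PowerSeries.C ((j : ℝ) / 2) * (pw s (j - 2) * e2 - e)
  have h' := congrArg (PowerSeries.coeff (n + 1)) h
  rw [sub_mul, one_mul, smul_mul_assoc] at h'
  simp only [map_sub, PowerSeries.coeff_smul, PowerSeries.coeff_succ_X_mul, coeff_θ, smul_eq_mul]
    at h'
  push_cast at h'
  linear_combination h'

lemma coeff_pw (hs : s.val * s.val = 1 - (4 : ℝ) • PowerSeries.X)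
    (h0 : PowerSeries.coeff 0 (s : PowerSeries ℝ) = 1) (j : ℤ) (n : ℕ) :
    PowerSeries.coeff n (pw s j)
      = 4 ^ n * (∏ i ∈ Finset.range n, (-(j : ℝ) / 2 + i)) / n.factorial := by
  have h1 : PowerSeries.constantCoeff (pw s j) = 1 := by
    have hu : Units.map (PowerSeries.constantCoeff (R := ℝ)).toMonoidHom s = 1 := by
      ext
      simpa using h0
    have := congrArg (fun u : ℝˣ => ((u ^ j : ℝˣ) : ℝ)) hu
    simp only [← map_zpow, one_zpow, Units.val_one] at this
    exact this
  induction n with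
  | zero => simp [h1]
  | succ n ih =>
    have h := coeff_pw_succ s hs j n
    rw [ih] at h
    have hn : (n : ℝ) + 1 ≠ 0 := by positivity
    have hf : (n.factorial : ℝ) ≠ 0 := by positivity
    rw [Finset.prod_range_succ, Nat.factorial_succ]
    push_cast
    field_simp at h ⊢
    linear_combination h

lemma tendsto_prod (a : ℝ) :
    Tendsto (fun n : ℕ => (∏ i ∈ Finset.range n, (a + i)) / n.factorial * (n : ℝ) ^ (1 - a))
      atTop (nhds (Real.Gamma a)⁻¹) := by
  by_cases ha : ∃ m : ℕ, a = -m
  · obtain ⟨m, rfl⟩ := ha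
    rw [Real.Gamma_neg_nat_eq_zero, inv_zero]
    refine tendsto_const_nhds.congr' ?_
    filter_upwards [eventually_gt_atTop m] with n hn
    rw [Finset.prod_eq_zero (Finset.mem_range.2 hn) (by simp)]
    simp
  · push Not at ha
    have h1 := (Real.GammaSeq_tendsto_Gamma a).inv₀ (Real.Gamma_ne_zero ha)
    have h2 : Tendsto (fun n : ℕ => (n : ℝ) / (n + a)) atTop (nhds 1) := by
      have : Tendsto (fun n : ℕ => (1 + a / n)⁻¹) atTop (nhds (1 + 0)⁻¹) :=
        (tendsto_const_nhds.add (tendsto_const_div_atTop_nhds_zero_nat a)).inv₀ (by norm_num)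
      rw [add_zero, inv_one] at this
      refine this.congr' ?_
      filter_upwards [eventually_gt_atTop 0] with n hn
      have : (n : ℝ) ≠ 0 := by positivity
      rw [show 1 + a / n = (n + a) / n by field_simp, inv_div]
    have h3 := h1.mul h2
    rw [mul_one] at h3
    refine h3.congr' ?_
    filter_upwards [eventually_gt_atTop 0] with n hn
    have hn' : (0 : ℝ) < n := by positivity
    have hna : (n : ℝ) + a ≠ 0 := by
      intro h; exact ha n (by linarith)
    have hp : (n : ℝ) ^ a ≠ 0 := (Real.rpow_pos_of_pos hn' a).ne'
    rw [Real.GammaSeq, Finset.prod_range_succ, Real.rpow_sub hn', Real.rpow_one]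
    have hf : (n.factorial : ℝ) ≠ 0 := by positivity
    rw [inv_div, add_comm a (n : ℝ)]
    field_simp

/-- normalised coefficient -/
noncomputable def nc (d : ℤ) (f : PowerSeries ℝ) (n : ℕ) : ℝ :=
  PowerSeries.coeff n f / 4 ^ n * (n : ℝ) ^ (1 + (d : ℝ) / 2)

lemma tendsto_pw (hs : s.val * s.val = 1 - (4 : ℝ) • PowerSeries.X)
    (h0 : PowerSeries.coeff 0 (s : PowerSeries ℝ) = 1) (j : ℤ) :
    Tendsto (nc j (pw s j)) atTop (nhds (Real.Gamma (-(j : ℝ) / 2))⁻¹) := by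
  refine (tendsto_prod (-(j : ℝ) / 2)).congr fun n => ?_
  rw [nc, coeff_pw s hs h0, show 1 - -(j : ℝ) / 2 = 1 + (j : ℝ) / 2 by ring]
  have hf : (n.factorial : ℝ) ≠ 0 := by positivity
  field_simp

def V (d : ℤ) : Submodule ℝ (PowerSeries ℝ) :=
  Submodule.span ℝ {f | ∃ j : ℤ, d ≤ j ∧ f = pw s j}

variable {s}

lemma pw_mem {d j : ℤ} (h : d ≤ j) : pw s j ∈ V s d := Submodule.subset_span ⟨j, h, rfl⟩

lemma V_mono {d e : ℤ} (h : d ≤ e) : V s e ≤ V s d := by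
  refine Submodule.span_mono ?_
  rintro f ⟨j, hj, rfl⟩
  exact ⟨j, h.trans hj, rfl⟩

lemma V_mul {d e : ℤ} {f g : PowerSeries ℝ} (hf : f ∈ V s d) (hg : g ∈ V s e) :
    f * g ∈ V s (d + e) := by
  have h := Submodule.mul_mem_mul hf hg
  rw [V, V, Submodule.span_mul_span] at h
  refine Submodule.span_mono ?_ h
  rintro _ ⟨_, ⟨i, hi, rfl⟩, _, ⟨j, hj, rfl⟩, rfl⟩
  exact ⟨i + j, by omega, (pw_add s i j).symm⟩

lemma V_θ (hs : s.val * s.val = 1 - (4 : ℝ) • PowerSeries.X) {d : ℤ}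
    {f : PowerSeries ℝ} (hf : f ∈ V s d) : θ f ∈ V s (d - 2) := by
  have : V s d ≤ (V s (d - 2)).comap θ := by
    rw [V, Submodule.span_le]
    rintro _ ⟨j, hj, rfl⟩
    rw [SetLike.mem_coe, Submodule.mem_comap, θ_pw s hs]
    exact Submodule.smul_mem _ _ (Submodule.sub_mem _ (pw_mem (by omega)) (pw_mem (by omega)))
  exact this hf

lemma V_tendsto (hs : s.val * s.val = 1 - (4 : ℝ) • PowerSeries.X)
    (h0 : PowerSeries.coeff 0 (s : PowerSeries ℝ) = 1) {d : ℤ}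
    {f : PowerSeries ℝ} (hf : f ∈ V s (d + 1)) : Tendsto (nc d f) atTop (nhds 0) := by
  induction hf using Submodule.span_induction with
  | mem f hf =>
    obtain ⟨j, hj, rfl⟩ := hf
    have h1 := tendsto_pw s hs h0 j
    have hpos : (0 : ℝ) < ((j : ℝ) - d) / 2 := by
      have : (d : ℝ) + 1 ≤ j := by exact_mod_cast hj
      linarith
    have h2 := (tendsto_rpow_neg_atTop hpos).comp tendsto_natCast_atTop_atTop
    have h3 := h1.mul h2
    rw [mul_zero] at h3
    refine h3.congr' ?_
    filter_upwards [eventually_gt_atTop 0] with n hn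
    have hn' : (0 : ℝ) < n := by positivity
    show nc j (pw s j) n * (n : ℝ) ^ (-(((j : ℝ) - d) / 2)) = _
    rw [nc, nc, mul_assoc, ← Real.rpow_add hn']
    congr 2
    ring
  | zero => exact tendsto_const_nhds.congr fun n => by simp [nc]
  | add f g _ _ h1 h2 =>
    have := h1.add h2
    rw [add_zero] at this
    refine this.congr fun n => ?_
    simp only [nc, map_add]; ring
  | smul c f _ h =>
    have := h.const_mul c
    rw [mul_zero] at this
    refine this.congr fun n => ?_
    simp only [nc, PowerSeries.coeff_smul, smul_eq_mul]; ring

/-- `f` has leading term `c s^d` -/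
def Ld (s : (PowerSeries ℝ)ˣ) (d : ℤ) (c : ℝ) (f : PowerSeries ℝ) : Prop :=
  f - c • pw s d ∈ V s (d + 1)

lemma Ld.mem {d : ℤ} {c : ℝ} {f : PowerSeries ℝ} (h : Ld s d c f) : f ∈ V s d := by
  have := Submodule.add_mem _ (V_mono (by omega : d ≤ d + 1) h)
    (Submodule.smul_mem (V s d) c (pw_mem (s := s) le_rfl))
  simpa using this

lemma Ld.of_mem {d : ℤ} {f : PowerSeries ℝ} (h : f ∈ V s (d + 1)) : Ld s d 0 f := by
  simpa [Ld] using h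

lemma Ld.add {d : ℤ} {c c' : ℝ} {f g : PowerSeries ℝ} (h : Ld s d c f) (h' : Ld s d c' g) :
    Ld s d (c + c') (f + g) := by
  have := Submodule.add_mem _ h h'
  rw [Ld]
  convert this using 1
  rw [add_smul]; abel

lemma Ld.smul {d : ℤ} {c : ℝ} {f : PowerSeries ℝ} (a : ℝ) (h : Ld s d c f) :
    Ld s d (a * c) (a • f) := by
  have := Submodule.smul_mem _ a h
  rw [Ld]
  convert this using 1
  rw [smul_sub, smul_smul]

lemma Ld.sum {ι : Type*} (S : Finset ι) {d : ℤ} {c : ι → ℝ} {f : ι → PowerSeries ℝ}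
    (h : ∀ i ∈ S, Ld s d (c i) (f i)) : Ld s d (∑ i ∈ S, c i) (∑ i ∈ S, f i) := by
  rw [Ld, Finset.sum_smul, ← Finset.sum_sub_distrib]
  exact Submodule.sum_mem _ h

lemma Ld.mul {d e : ℤ} {c c' : ℝ} {f g : PowerSeries ℝ} (h : Ld s d c f) (h' : Ld s e c' g) :
    Ld s (d + e) (c * c') (f * g) := by
  have h1 := V_mul h h'.mem
  have h2 := V_mul (Submodule.smul_mem _ c (pw_mem (s := s) (le_refl d))) h'
  rw [Ld]
  have h3 := Submodule.add_mem _ (V_mono (by omega : d + e + 1 ≤ d + 1 + e) h1)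
    (V_mono (by omega : d + e + 1 ≤ d + (e + 1)) h2)
  convert h3 using 1
  rw [pw_add]
  simp only [PowerSeries.smul_eq_C_mul, map_mul]
  ring

lemma Ld.θ (hs : s.val * s.val = 1 - (4 : ℝ) • PowerSeries.X) {d : ℤ} {c : ℝ}
    {f : PowerSeries ℝ} (h : Ld s d c f) : Ld s (d - 2) (-(d : ℝ) / 2 * c) (TH.θ f) := by
  have h1 := V_θ hs h
  rw [map_sub, map_smul, θ_pw s hs] at h1
  have h2 : (c * (d : ℝ) / 2) • pw s d ∈ V s (d - 2 + 1) :=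
    Submodule.smul_mem _ _ (pw_mem (by omega))
  have h3 := Submodule.add_mem _ (V_mono (by omega : d - 2 + 1 ≤ d + 1 - 2) h1) h2
  rw [Ld]
  convert h3 using 1
  module

lemma Ld.congr {d d' : ℤ} {c c' : ℝ} {f : PowerSeries ℝ} (h : Ld s d c f) (hd : d = d')
    (hc : c = c') : Ld s d' c' f := by
  subst hd hc; exact h

lemma Ld.tendsto (hs : s.val * s.val = 1 - (4 : ℝ) • PowerSeries.X)
    (h0 : PowerSeries.coeff 0 (s : PowerSeries ℝ) = 1) {d : ℤ} {c : ℝ}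
    {f : PowerSeries ℝ} (hf : Ld s d c f) :
    Tendsto (nc d f) atTop (nhds (c * (Real.Gamma (-(d : ℝ) / 2))⁻¹)) := by
  have h1 := V_tendsto hs h0 hf
  have h2 := (tendsto_pw s hs h0 d).const_mul c
  have := h1.add h2
  rw [zero_add] at this
  refine this.congr fun n => ?_
  simp only [nc, map_sub, PowerSeries.coeff_smul, smul_eq_mul]; ring

end unit

/-- leading coefficients -/
noncomputable def gam : ℕ → ℝ
  | 0 => -1/2
  | 1 => 1/4
  | 2 => 5/8
  | 3 => 45/8
  | 4 => 3315/32
  | 5 => 25425/8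
  | 6 => 18635625/128
  | 7 => 18592875/2
  | 8 => 403839930375/512
  | _ => 0

lemma gam_rec (k : ℕ) (hk : k < 8) :
    gam (k + 1) = (k + 1 : ℝ) * ((3 * k - 1) / 2 * gam k) +
      ∑ i ∈ Finset.range k, ((k + 1).choose (i + 1) : ℝ) * (gam (i + 1) * gam (k - i)) := by
  interval_cases k <;> norm_num [Finset.sum_range_succ, gam, Nat.choose]

section main

lemma G_coeff_zero (U : ℕ → Finset PTree)
    (hU : ∀ N t, t ∈ U N ↔ t.size + 1 = 2 * N ∧ t.validDeg {2}) (k : ℕ) : PowerSeries.constantCoeff (G U k) = 0 := by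
  have : U 0 = ∅ := by
    ext t; simp [hU]
  rw [← PowerSeries.coeff_zero_eq_constantCoeff_apply]
  simp [G, this]

lemma exists_s (U : ℕ → Finset PTree)
    (hU : ∀ N t, t ∈ U N ↔ t.size + 1 = 2 * N ∧ t.validDeg {2}) : ∃ s : (PowerSeries ℝ)ˣ, s.val * s.val = 1 - (4 : ℝ) • PowerSeries.X ∧
    PowerSeries.coeff 0 s.val = 1 ∧ s.val = 1 - (2 : ℝ) • G U 0 := by
  have hc : PowerSeries.constantCoeff (1 - (2 : ℝ) • G U 0) = 1 := by
    rw [PowerSeries.smul_eq_C_mul, map_sub, map_mul, G_coeff_zero U hU]; simp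
  have hu : IsUnit (1 - (2 : ℝ) • G U 0) := by
    rw [PowerSeries.isUnit_iff_constantCoeff, hc]; exact isUnit_one
  obtain ⟨s, hs⟩ := hu
  refine ⟨s, ?_, ?_, hs⟩
  · have h := G_eq U hU 0
    simp only [if_true, zero_add, Finset.sum_range_one, Nat.choose_self, Nat.cast_one, one_smul,
      D_zero, Nat.sub_self] at h
    rw [hs, PowerSeries.smul_eq_C_mul, PowerSeries.smul_eq_C_mul]
    have h2 : (PowerSeries.C (2 : ℝ)) = 2 := map_ofNat _ 2
    have h4 : (PowerSeries.C (4 : ℝ)) = 4 := map_ofNat _ 4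
    rw [h2, h4]
    linear_combination (-4) * h
  · rw [hs]; simpa using hc

lemma G_lead (U : ℕ → Finset PTree)
    (hU : ∀ N t, t ∈ U N ↔ t.size + 1 = 2 * N ∧ t.validDeg {2}) (s : (PowerSeries ℝ)ˣ) (hs : s.val * s.val = 1 - (4 : ℝ) • PowerSeries.X)
    (hG : s.val = 1 - (2 : ℝ) • G U 0) (k : ℕ) (hk : k < 8) :
    Ld s (1 - 3 * ((k : ℤ) + 1)) (gam (k + 1)) (G U (k + 1)) := by
  have hθ0 : Ld s (-1) (1 / 4) (θ (G U 0)) := by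
    have e : G U 0 = (1 / 2 : ℝ) • 1 - (1 / 2 : ℝ) • pw s 1 := by
      rw [pw_one, hG]; module
    have h1 : Ld s 1 (-1 / 2) ((-1 / 2 : ℝ) • pw s 1) := by
      simp [Ld]
    have h2 := h1.θ hs
    rw [e, map_sub, map_smul, θ_one]
    rw [show (1 / 2 : ℝ) • (0 : PowerSeries ℝ) - (θ ((1 / 2 : ℝ) • pw s 1))
      = θ ((-1 / 2 : ℝ) • pw s 1) by rw [map_smul, map_smul]; module]
    exact h2.congr (by norm_num) (by norm_num)
  induction k using Nat.strong_induction_on with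
  | _ k ih =>
  -- membership of derivatives
  have hmem : ∀ i ≤ k, ∀ j : ℕ, (θ^[j + 1]) (G U i) ∈ V s (1 - 3 * (i : ℤ) - 2 * ((j : ℤ) + 1)) := by
    intro i hi j
    induction j with
    | zero =>
      cases i with
      | zero => simpa using hθ0.mem
      | succ i =>
        have := V_θ hs (ih i (by omega) (by omega)).mem
        simpa using this
    | succ j ihj =>
      rw [Function.iterate_succ_apply']
      have := V_θ hs ihj
      refine V_mono ?_ this
      push_cast; omega
  have hθ : ∀ i ≤ k, Ld s (1 - 3 * (i : ℤ) - 2) ((3 * i - 1) / 2 * gam i) (θ (G U i)) := by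
    intro i hi
    cases i with
    | zero => exact hθ0.congr (by norm_num) (by norm_num [gam])
    | succ i =>
      refine ((ih i (by omega) (by omega)).θ hs).congr (by push_cast; ring) (by push_cast; ring)
  -- the lower-order part of `D`
  have hDs : ∀ i, D U (i + 1) = G U (i + 1) + ∑ j ∈ Finset.range (i + 1),
      ((i + 1).choose (j + 1) : ℝ) • (θ^[j + 1]) (G U (i - j)) := by
    intro i
    rw [D_eq, Finset.sum_range_succ', add_comm]
    simp
  have hR : ∀ i ≤ k, Ld s (2 - 3 * ((i : ℤ) + 1)) ((i + 1 : ℝ) * ((3 * i - 1) / 2 * gam i))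
      (∑ j ∈ Finset.range (i + 1), ((i + 1).choose (j + 1) : ℝ) • (θ^[j + 1]) (G U (i - j))) := by
    intro i hi
    rw [Finset.sum_range_succ']
    have h1 : Ld s (2 - 3 * ((i : ℤ) + 1)) 0
        (∑ j ∈ Finset.range i, ((i + 1).choose (j + 1 + 1) : ℝ) •
          (θ^[j + 1 + 1]) (G U (i - (j + 1)))) := by
      refine Ld.of_mem (Submodule.sum_mem _ fun j hj => Submodule.smul_mem _ _ ?_)
      rw [Finset.mem_range] at hj
      refine V_mono ?_ (hmem (i - (j + 1)) (by omega) (j + 1))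
      push_cast [Nat.cast_sub (show j + 1 ≤ i by omega)]
      omega
    have h2 := (hθ i hi).smul ((i : ℝ) + 1)
    have h := h1.add (h2.congr (d' := 2 - 3 * ((i : ℤ) + 1)) (by ring) rfl)
    rw [zero_add] at h
    simpa using h
  have hD : ∀ i < k, Ld s (1 - 3 * ((i : ℤ) + 1)) (gam (i + 1)) (D U (i + 1)) := by
    intro i hi
    rw [hDs]
    refine ((ih i hi (by omega)).add (Ld.of_mem (V_mono (by omega) (hR i hi.le).mem))).congr rfl
      (by ring)
  -- the equation
  have hE := G_eq U hU (k + 1)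
  rw [if_neg (by omega), zero_add, Finset.sum_range_succ, Finset.sum_range_succ'] at hE
  simp only [Nat.choose_self, Nat.choose_zero_right, Nat.cast_one, one_smul, Nat.sub_self,
    Nat.sub_zero, D_zero, Nat.add_sub_add_right] at hE
  rw [hDs k] at hE
  set R := ∑ j ∈ Finset.range (k + 1), ((k + 1).choose (j + 1) : ℝ) • (θ^[j + 1]) (G U (k - j))
    with hRdef
  set Q := ∑ i ∈ Finset.range k, ((k + 1).choose (i + 1) : ℝ) • (D U (i + 1) * D U (k - i))
    with hQdef
  have hQ : Ld s (2 - 3 * ((k : ℤ) + 1)) (∑ i ∈ Finset.range k,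
      ((k + 1).choose (i + 1) : ℝ) * (gam (i + 1) * gam (k - i))) Q := by
    refine Ld.sum _ fun i hi => Ld.smul _ ?_
    rw [Finset.mem_range] at hi
    obtain ⟨j, rfl⟩ : ∃ j, k = i + j + 1 := ⟨k - i - 1, by omega⟩
    rw [show i + j + 1 - i = j + 1 by omega]
    refine ((hD i (by omega)).mul (hD j (by omega))).congr ?_ rfl
    push_cast; ring
  have hfin : G U (k + 1) = pw s (-1) * (R + Q) - R := by
    have h3 : pw s (-1) * s.val = 1 := by rw [← pw_one s, ← pw_add, ← pw_zero s]; norm_num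
    have h2 : (2 : ℝ) • G U 0 = 2 * G U 0 := by
      rw [PowerSeries.smul_eq_C_mul, show PowerSeries.C (2 : ℝ) = 2 from map_ofNat _ 2]
    rw [h2] at hG
    have e : s.val * (G U (k + 1) + R) = R + Q := by
      rw [hG]
      linear_combination hE
    linear_combination pw s (-1) * e - (G U (k + 1) + R) * h3
  have hp : Ld s (-1) 1 (pw s (-1)) := by simp [Ld]
  have hA := hp.mul ((hR k le_rfl).add hQ)
  have hB : Ld s (-1 + (2 - 3 * ((k : ℤ) + 1))) 0 ((-1 : ℝ) • R) :=
    Ld.of_mem (Submodule.smul_mem _ _ (V_mono (by omega) (hR k le_rfl).mem))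
  rw [hfin, show pw s (-1) * (R + Q) - R = pw s (-1) * (R + Q) + (-1 : ℝ) • R by module]
  refine (hA.add hB).congr (by ring) ?_
  rw [gam_rec k hk]; ring

lemma G_tendsto (U : ℕ → Finset PTree)
    (hU : ∀ N t, t ∈ U N ↔ t.size + 1 = 2 * N ∧ t.validDeg {2}) (k : ℕ) (hk : k ≤ 8) :
    Tendsto (nc (1 - 3 * (k : ℤ)) (G U k)) atTop
      (nhds (gam k * (Real.Gamma ((3 * k - 1) / 2))⁻¹)) := by
  obtain ⟨s, hs, h0, hG⟩ := exists_s U hU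
  cases k with
  | zero =>
    have h := (tendsto_pw s hs h0 1).const_mul (-1 / 2)
    have e : G U 0 = (1 / 2 : ℝ) • 1 - (1 / 2 : ℝ) • pw s 1 := by
      rw [pw_one, hG]; module
    have h' : Tendsto (nc (1 - 3 * ((0 : ℕ) : ℤ)) (G U 0)) atTop
        (nhds (-1 / 2 * (Real.Gamma (-((1 : ℤ) : ℝ) / 2))⁻¹)) := by
      refine h.congr' ?_
      filter_upwards [eventually_gt_atTop 0] with n hn
      rw [e]
      simp only [nc, map_sub, PowerSeries.coeff_smul, PowerSeries.coeff_one, hn.ne', if_false]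
      norm_num
      ring
    convert h' using 3
    · simp [gam]
    · norm_num
  | succ k =>
    have h := (G_lead U hU s hs hG k (by omega)).tendsto hs h0
    convert h using 3
    · push_cast; ring
    · push_cast; ring_nf

end main

/-- limits of the normalised moments -/
noncomputable def Mo (k : ℕ) : ℝ :=
  (gam k * (Real.Gamma ((3 * k - 1) / 2))⁻¹) / (gam 0 * (Real.Gamma ((3 * (0 : ℕ) - 1) / 2))⁻¹)

lemma Gamma_half_neg : Real.Gamma (-1 / 2) = -2 * √π := by
  have h := Real.Gamma_add_one (show (-1 / 2 : ℝ) ≠ 0 by norm_num)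
  rw [show (-1 / 2 : ℝ) + 1 = 1 / 2 by norm_num, Real.Gamma_one_half_eq] at h
  linarith

lemma Gamma_step (x y : ℝ) (hx : x ≠ 0) (h : y = x + 1) : Real.Gamma y = x * Real.Gamma x := by
  rw [h, Real.Gamma_add_one hx]

lemma Mo_eq (k : ℕ) : Mo k = gam k * (Real.Gamma ((3 * k - 1) / 2))⁻¹ * (4 * √π) := by
  have : √π ≠ 0 := (Real.sqrt_pos.2 Real.pi_pos).ne'
  have h0 : gam 0 = -1 / 2 := rfl
  rw [Mo, h0, show (3 * ((0 : ℕ) : ℝ) - 1) / 2 = -1 / 2 by norm_num, Gamma_half_neg]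
  field_simp
  norm_num

lemma Mo_zero : Mo 0 = 1 := by
  have : √π ≠ 0 := (Real.sqrt_pos.2 Real.pi_pos).ne'
  have h0 : gam 0 = -1 / 2 := rfl
  rw [Mo_eq, h0, show (3 * ((0 : ℕ) : ℝ) - 1) / 2 = -1 / 2 by norm_num, Gamma_half_neg]
  field_simp
  norm_num

lemma Mo_odd (k m : ℕ) (h : (3 * (k : ℝ) - 1) / 2 = m + 1) :
    Mo k = gam k / m.factorial * 4 * √π := by
  rw [Mo_eq, h, Real.Gamma_nat_eq_factorial]; ring

open scoped Nat in
lemma Mo_even (k m : ℕ) (h : (3 * (k : ℝ) - 1) / 2 = m + 1 / 2) :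
    Mo k = gam k * 4 * 2 ^ m / (2 * m - 1 : ℕ)‼ := by
  have : √π ≠ 0 := (Real.sqrt_pos.2 Real.pi_pos).ne'
  rw [Mo_eq, h, Real.Gamma_nat_add_half]
  field_simp

open scoped Nat in
lemma df (n : ℕ) : (n + 2)‼ = (n + 2) * n‼ := Nat.doubleFactorial_add_two n

lemma Mo1 : Mo 1 = 1 * √π := by
  rw [Mo_odd 1 0 (by norm_num)]
  norm_num [gam, Nat.factorial]

lemma Mo2 : Mo 2 = 10/3 := by
  rw [Mo_even 2 2 (by norm_num)]
  norm_num [gam, df]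

lemma Mo3 : Mo 3 = 15/4 * √π := by
  rw [Mo_odd 3 3 (by norm_num)]
  norm_num [gam, Nat.factorial]

lemma Mo4 : Mo 4 = 884/63 := by
  rw [Mo_even 4 5 (by norm_num)]
  norm_num [gam, df]

lemma Mo5 : Mo 5 = 565/32 * √π := by
  rw [Mo_odd 5 6 (by norm_num)]
  norm_num [gam, Nat.factorial]

lemma Mo6 : Mo 6 = 662600/9009 := by
  rw [Mo_even 6 8 (by norm_num)]
  norm_num [gam, df]

lemma Mo7 : Mo 7 = 19675/192 * √π := by
  rw [Mo_odd 7 9 (by norm_num)]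
  norm_num [gam, Nat.factorial]

lemma Mo8 : Mo 8 = 4102500880/8729721 := by
  rw [Mo_even 8 11 (by norm_num)]
  norm_num [gam, df]


/-- limit of central moments -/
noncomputable def Cm (i : ℕ) : ℝ :=
  ∑ j ∈ Finset.range (i + 1), Mo j * (-Mo 1) ^ (i - j) * (i.choose j)

lemma Cm2 : Cm 2 = (10 - 3 * π) / 3 := by
  have h : √π ^ 2 = π := Real.sq_sqrt Real.pi_pos.le
  simp only [Cm, Finset.sum_range_succ, Finset.sum_range_zero, Mo_zero, Mo1, Mo2, Nat.choose]
  generalize √π = a at h ⊢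
  rw [← h]
  norm_num
  ring

lemma Cm8 : Cm 8 = (1 / 81) * ((3 / 2586584) * (-488864376 * π ^ 4 - 8147739600 * π ^ 3 - 455885430 * π ^ 2 + 86568885375 * π + 32820007040)) := by
  have h : √π ^ 2 = π := Real.sq_sqrt Real.pi_pos.le
  simp only [Cm, Finset.sum_range_succ, Finset.sum_range_zero, Mo_zero, Mo1, Mo2, Mo3, Mo4, Mo5,
    Mo6, Mo7, Mo8, Nat.choose]
  generalize √π = a at h ⊢
  rw [← h]
  norm_num
  ring

lemma central {ι : Type*} (S : Finset ι) (f : ι → ℝ) (c q : ℝ) (i : ℕ) :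
    (∑ t ∈ S, (f t + c) ^ i) / q
      = ∑ j ∈ Finset.range (i + 1), ((∑ t ∈ S, f t ^ j) / q) * c ^ (i - j) * (i.choose j) := by
  simp only [add_pow]
  rw [Finset.sum_comm, Finset.sum_div]
  refine Finset.sum_congr rfl fun j _ => ?_
  rw [← Finset.sum_mul, ← Finset.sum_mul]
  ring

end TH

/-- Let `H_n` be the total height (sum over all vertices of the distance to the root) on
complete binary trees with `2n+1` vertices, under the uniform distribution; with mean
`μ n`, central moments `m i n`, and scaled moments `α i n = m i n / (m 2 n)^(i/2)`,
the `8`-th scaled moment converges as `n → ∞` to the stated constant. -/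
theorem totalheight_stmt12 (T : ℕ → Finset PTree)
    (hT : ∀ n : ℕ, ∀ t : PTree, t ∈ T n ↔ t.size = 2 * n + 1 ∧ t.validDeg {2})
    (μ : ℕ → ℝ)
    (hμ : ∀ n : ℕ, μ n = (∑ t ∈ T n, (t.totalHeight : ℝ)) / ((T n).card : ℝ))
    (m : ℕ → ℕ → ℝ)
    (hm : ∀ i n : ℕ, m i n =
      (∑ t ∈ T n, ((t.totalHeight : ℝ) - μ n) ^ i) / ((T n).card : ℝ))
    (α : ℕ → ℕ → ℝ)
    (hα : ∀ i n : ℕ, α i n = m i n / (m 2 n) ^ ((i : ℝ) / 2)) :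
    Tendsto (fun n : ℕ => α 8 n) atTop
      (nhds ((3 / 2586584) * (-488864376 * π ^ 4 - 8147739600 * π ^ 3 - 455885430 * π ^ 2 + 86568885375 * π + 32820007040) / (10 - 3 * π) ^ 4)) := by
  classical
  set U : ℕ → Finset PTree := fun N => if N = 0 then ∅ else T (N - 1) with hUdef
  have hU : ∀ N t, t ∈ U N ↔ t.size + 1 = 2 * N ∧ t.validDeg {2} := by
    intro N t
    cases N with
    | zero => simp [hUdef]
    | succ n =>
      have e : U (n + 1) = T n := by simp [hUdef]
      rw [e, hT]
      constructor
      · rintro ⟨h1, h2⟩; exact ⟨by omega, h2⟩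
      · rintro ⟨h1, h2⟩; exact ⟨by omega, h2⟩
  have hU1 : ∀ n, U (n + 1) = T n := by intro n; simp [hUdef]
  -- normalised moments
  set E : ℕ → ℕ → ℝ := fun k n => (∑ t ∈ T n, TH.epl t ^ k) / ((T n).card : ℝ) with hE
  set y : ℕ → ℝ := fun n => ((n + 1 : ℕ) : ℝ) ^ (3 / 2 : ℝ) with hy
  have hypos : ∀ n, 0 < y n := fun n => Real.rpow_pos_of_pos (by positivity) _
  have hG : ∀ k n, PowerSeries.coeff (n + 1) (TH.G U k) = ∑ t ∈ T n, TH.epl t ^ k := by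
    intro k n
    simp [TH.G, hU1]
  have hG0 : ∀ n, PowerSeries.coeff (n + 1) (TH.G U 0) = ((T n).card : ℝ) := by
    intro n; rw [hG]; simp
  have hnz : TH.gam 0 * (Real.Gamma ((3 * (0 : ℕ) - 1) / 2))⁻¹ ≠ 0 := by
    have h0 : TH.gam 0 = -1 / 2 := rfl
    have : √π ≠ 0 := (Real.sqrt_pos.2 Real.pi_pos).ne'
    rw [h0, show (3 * ((0 : ℕ) : ℝ) - 1) / 2 = -1 / 2 by norm_num, TH.Gamma_half_neg]
    simp [this]
  have hx : ∀ k ≤ 8, Tendsto (fun n => E k n / y n ^ k) atTop (nhds (TH.Mo k)) := by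
    intro k hk
    have h := ((TH.G_tendsto U hU k hk).div (TH.G_tendsto U hU 0 (by norm_num)) hnz).comp
      (tendsto_add_atTop_nat 1)
    refine h.congr fun n => ?_
    simp only [Function.comp, Pi.div_apply, TH.nc]
    rw [hG0, hG]
    have hn : (0 : ℝ) < ((n + 1 : ℕ) : ℝ) := by positivity
    have e1 : ((n + 1 : ℕ) : ℝ) ^ (1 + ((1 - 3 * (k : ℤ) : ℤ) : ℝ) / 2) = y n / y n ^ k := by
      simp only [hy]
      rw [← Real.rpow_natCast (((n + 1 : ℕ) : ℝ) ^ (3 / 2 : ℝ)) k, ← Real.rpow_mul hn.le,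
        ← Real.rpow_sub hn]
      congr 1
      push_cast; ring
    have e2 : ((n + 1 : ℕ) : ℝ) ^ (1 + ((1 - 3 * ((0 : ℕ) : ℤ) : ℤ) : ℝ) / 2) = y n := by
      simp only [hy]
      congr 1
      norm_num
    rw [e1, e2]
    have := (hypos n).ne'
    have h4 : (4 : ℝ) ^ (n + 1) ≠ 0 := by positivity
    simp only [hE]
    by_cases hc : ((T n).card : ℝ) = 0
    · simp [hc]
    · field_simp
  have hcard : ∀ᶠ n in atTop, ((T n).card : ℝ) ≠ 0 := by
    have h := (((TH.G_tendsto U hU 0 (by norm_num))).comp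
      (tendsto_add_atTop_nat 1)).eventually_ne hnz
    filter_upwards [h] with n hn hc
    apply hn
    simp only [Function.comp, TH.nc]
    rw [hG0, hc]; simp
  set C : ℕ → ℕ → ℝ := fun i n => ∑ j ∈ Finset.range (i + 1),
    (E j n / y n ^ j) * (-(E 1 n / y n ^ 1)) ^ (i - j) * (i.choose j) with hC
  have hClim : ∀ i ≤ 8, Tendsto (C i) atTop (nhds (TH.Cm i)) := by
    intro i hi
    refine tendsto_finsetSum _ fun j hj => ?_
    rw [Finset.mem_range] at hj
    exact ((hx j (by omega)).mul (((hx 1 (by norm_num)).neg).pow _)).mul_const _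
  have hmC : ∀ i n, ((T n).card : ℝ) ≠ 0 → m i n = (2 * y n) ^ i * C i n := by
    intro i n hc
    have hH : ∀ t ∈ T n, (t.totalHeight : ℝ) = 2 * TH.epl t - 2 * n := by
      intro t ht
      have h1 := ((hT n t).1 ht).1
      have h2 : (t.size : ℝ) = 2 * n + 1 := by exact_mod_cast h1
      rw [TH.epl, h2]; ring
    have hmu : μ n = 2 * E 1 n - 2 * n := by
      rw [hμ, Finset.sum_congr rfl hH, Finset.sum_sub_distrib, ← Finset.mul_sum]
      simp only [hE, pow_one, Finset.sum_const, nsmul_eq_mul]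
      field_simp
    rw [hm, Finset.sum_congr rfl (g := fun t => 2 ^ i * (TH.epl t + -(E 1 n)) ^ i)
      (fun t ht => by rw [hH t ht, hmu, ← mul_pow]; ring), ← Finset.mul_sum, mul_div_assoc,
      TH.central, mul_pow, mul_assoc]
    congr 1
    simp only [hC, Finset.mul_sum]
    refine Finset.sum_congr rfl fun j hj => ?_
    rw [Finset.mem_range] at hj
    obtain ⟨l, rfl⟩ : ∃ l, i = j + l := ⟨i - j, by omega⟩
    have hyn := (hypos n).ne'
    change E j n * _ * _ = _
    generalize E j n = e1
    generalize E 1 n = e2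
    generalize y n = z at hyn
    rw [Nat.add_sub_cancel_left, pow_one, ← neg_div, div_pow, pow_add]
    field_simp
  have hpi : 10 - 3 * π ≠ 0 := by
    have := Real.pi_lt_d2
    intro h; linarith
  have hfin : Tendsto (fun n => C 8 n / C 2 n ^ 4) atTop (nhds (TH.Cm 8 / TH.Cm 2 ^ 4)) := by
    refine (hClim 8 le_rfl).div ((hClim 2 (by norm_num)).pow 4) ?_
    rw [TH.Cm2]
    exact pow_ne_zero _ (div_ne_zero hpi (by norm_num))
  have hval : TH.Cm 8 / TH.Cm 2 ^ 4 = (3 / 2586584) * (-488864376 * π ^ 4 - 8147739600 * π ^ 3 - 455885430 * π ^ 2 + 86568885375 * π + 32820007040) / (10 - 3 * π) ^ 4 := by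
    rw [TH.Cm8, TH.Cm2, div_pow, div_div_eq_mul_div]
    congr 1
    ring
  rw [← hval]
  refine hfin.congr' ?_
  filter_upwards [hcard] with n hc
  rw [hα, show (((8 : ℕ) : ℝ) / 2) = ((4 : ℕ) : ℝ) by norm_num, Real.rpow_natCast, hmC 8 n hc,
    hmC 2 n hc, mul_pow ((2 * y n) ^ 2), ← pow_mul]
  have := hypos n
  rw [mul_div_mul_left _ _ (by positivity)]
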